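/- Let 𝒜 = {L_1, …, L_n} be n ≥ 1 pairwise distinct affine lines in ℂ² and let R be a commutative ring. Let a_1, …, a_n ∈ R with a_1 + ⋯ + a_n a unit of R, and let c_1, …, c_n ∈ R with c_1 + ⋯ + c_n = 0. Set ξ = a_1 e_1 + ⋯ + a_n e_n and η = c_1 e_1 + ⋯ + c_n e_n in Λ(R^n). If ξ ∧ η ∈ I_R(𝒜), then for every parallel class C of 𝒜 one has Σ_{i ∈ C} c_i = 0. (That is, η lies in the kernel of the total degeneration homomorphism Δ_tot.) -/

import Mathlib

noncomputable section
open scoped Classical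

/-- `L` is an (affine) line in `ℂ²`: a nonempty affine subspace whose direction
has dimension one. -/
def IsLine (L : AffineSubspace ℂ (ℂ × ℂ)) : Prop :=
  (L : Set (ℂ × ℂ)).Nonempty ∧ Module.finrank ℂ L.direction = 1

/-- Indices `i`, `j` are parallel: `i = j` or the lines do not meet. -/
def Par {n : ℕ} (L : Fin n → AffineSubspace ℂ (ℂ × ℂ)) (i j : Fin n) : Prop :=
  i = j ∨ (L i : Set (ℂ × ℂ)) ∩ (L j : Set (ℂ × ℂ)) = ∅

/-- The image `e_i` of the `i`-th standard basis vector of `R^n` in `Λ(R^n)`. -/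
def gen (R : Type*) [CommRing R] (n : ℕ) (i : Fin n) :
    ExteriorAlgebra R (Fin n → R) :=
  ExteriorAlgebra.ι R (Pi.single i 1)

/-- Generators of the Orlik-Solomon ideal of the line arrangement `L`. -/
def osGens (R : Type*) [CommRing R] {n : ℕ}
    (L : Fin n → AffineSubspace ℂ (ℂ × ℂ)) :
    Set (ExteriorAlgebra R (Fin n → R)) :=
  {x | ∃ i j : Fin n, i ≠ j ∧ (L i : Set (ℂ × ℂ)) ∩ (L j : Set (ℂ × ℂ)) = ∅ ∧
        x = gen R n i * gen R n j} ∪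
  {x | ∃ i j k : Fin n, i ≠ j ∧ i ≠ k ∧ j ≠ k ∧
        ((L i : Set (ℂ × ℂ)) ∩ (L j : Set (ℂ × ℂ)) ∩ (L k : Set (ℂ × ℂ))).Nonempty ∧
        x = gen R n i * gen R n j - gen R n i * gen R n k + gen R n j * gen R n k}

/-- The Orlik-Solomon ideal `I_R(𝒜)`: the two-sided ideal generated by `osGens`. -/
def osIdeal (R : Type*) [CommRing R] {n : ℕ}
    (L : Fin n → AffineSubspace ℂ (ℂ × ℂ)) :
    TwoSidedIdeal (ExteriorAlgebra R (Fin n → R)) :=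
  TwoSidedIdeal.span (osGens R L)

/-- The parallel class of the index `i`, as a finset of indices. -/
def parClass {n : ℕ} (L : Fin n → AffineSubspace ℂ (ℂ × ℂ)) (i : Fin n) :
    Finset (Fin n) :=
  Finset.univ.filter (fun j => Par L i j)

/-- Two lines of `ℂ²` with distinct directions meet. -/
lemma IsLine.inter_nonempty_of_direction_ne {K M : AffineSubspace ℂ (ℂ × ℂ)}
    (hK : IsLine K) (hM : IsLine M) (h : K.direction ≠ M.direction) :
    ((K : Set (ℂ × ℂ)) ∩ (M : Set (ℂ × ℂ))).Nonempty := by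
  refine AffineSubspace.inter_nonempty_of_nonempty_of_sup_direction_eq_top hK.1 hM.1 ?_
  have hlt : K.direction < K.direction ⊔ M.direction := by
    refine lt_of_le_of_ne le_sup_left fun he => h ?_
    exact (Submodule.eq_of_le_of_finrank_eq (he ▸ le_sup_right) (hM.2.trans hK.2.symm)).symm
  have hrank := Submodule.finrank_lt_finrank_of_lt hlt
  apply Submodule.eq_top_of_finrank_eq
  have hle := Submodule.finrank_le (K.direction ⊔ M.direction)
  have h2 : Module.finrank ℂ (ℂ × ℂ) = 2 := by simp
  have := hK.2
  omega

/-- Lines of an arrangement are parallel exactly when they have the same direction. -/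
lemma par_iff_direction_eq {n : ℕ} {L : Fin n → AffineSubspace ℂ (ℂ × ℂ)}
    (hline : ∀ i, IsLine (L i)) (hdist : Function.Injective L) (i j : Fin n) :
    Par L i j ↔ (L i).direction = (L j).direction := by
  constructor
  · rintro (rfl | h)
    · rfl
    · by_contra hne
      exact ((hline i).inter_nonempty_of_direction_ne (hline j) hne).ne_empty h
  · intro h
    refine or_iff_not_imp_right.mpr fun hne => hdist ?_
    exact AffineSubspace.ext_of_direction_eq h (Set.nonempty_iff_ne_empty.mpr hne)

/-- The linear map `R^n → R²` whose coordinates are the sum of all coefficients and the sum of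
the coefficients indexed by `C`. -/
def sumPair (R : Type*) [CommRing R] {n : ℕ} (C : Finset (Fin n)) :
    (Fin n → R) →ₗ[R] (Fin 2 → R) :=
  LinearMap.pi ![∑ i, LinearMap.proj i, ∑ i ∈ C, LinearMap.proj i]

lemma sumPair_apply {R : Type*} [CommRing R] {n : ℕ} (C : Finset (Fin n)) (x : Fin n → R) :
    sumPair R C x = ![∑ i, x i, ∑ i ∈ C, x i] := by
  ext k
  fin_cases k <;> simp [sumPair]

lemma sumPair_single {R : Type*} [CommRing R] {n : ℕ} (C : Finset (Fin n)) (i : Fin n) :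
    sumPair R C (Pi.single i 1) = ![1, if i ∈ C then 1 else 0] := by
  simp [sumPair_apply]

lemma sum_smul_gen {R : Type*} [CommRing R] {n : ℕ} (x : Fin n → R) :
    ∑ i, x i • gen R n i = ExteriorAlgebra.ι R x := by
  conv_rhs => rw [pi_eq_sum_univ' x]
  simp only [gen, map_sum, map_smul]

/-- The relation attached to a triple of concurrent lines is a product of differences. -/
lemma ExteriorAlgebra.ι_mul_sub_add {R M : Type*} [CommRing R] [AddCommGroup M] [Module R M]
    (x y z : M) :
    ι R x * ι R y - ι R x * ι R z + ι R y * ι R z = ι R (y - x) * ι R (z - x) := by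
  have h : ι R y * ι R x = -(ι R x * ι R y) :=
    eq_neg_of_add_eq_zero_right (ι_add_mul_swap x y)
  simp only [map_sub, mul_sub, sub_mul, ι_sq_zero, h]
  abel

/-- Over a commutative ring, a product of two vectors of `R²` vanishes in the exterior algebra only
if their determinant vanishes. -/
lemma ExteriorAlgebra.det_eq_zero_of_ι_mul_ι_eq_zero {R : Type*} [CommRing R]
    {v w : Fin 2 → R} (h : ι R v * ι R w = 0) : v 0 * w 1 - v 1 * w 0 = 0 := by
  have h' := congrArg (liftAlternating (R := R)
    (Function.update 0 2 (Matrix.detRowAlternating (n := Fin 2) (R := R)))) h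
  have hm : ι R v * ι R w = ιMulti R 2 ![v, w] := by simp [ιMulti_apply]
  rw [hm, liftAlternating_apply_ιMulti, map_zero, Function.update_self] at h'
  rw [← h']
  exact (Matrix.det_fin_two ![v, w]).symm

/-- If `C` is a union of parallel classes, the Orlik–Solomon ideal vanishes under the map induced
by `sumPair`. -/
lemma map_sumPair_eq_zero_of_mem_osIdeal {R : Type*} [CommRing R] {n : ℕ}
    {L : Fin n → AffineSubspace ℂ (ℂ × ℂ)} {C : Finset (Fin n)}
    (hC : ∀ i j, Par L i j → (i ∈ C ↔ j ∈ C)) {x : ExteriorAlgebra R (Fin n → R)}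
    (hx : x ∈ osIdeal R L) : ExteriorAlgebra.map (sumPair R C) x = 0 := by
  suffices h : osIdeal R L ≤ TwoSidedIdeal.ker (ExteriorAlgebra.map (sumPair R C)) from
    (TwoSidedIdeal.mem_ker _).mp (h hx)
  refine TwoSidedIdeal.span_le.mpr ?_
  rintro _ (⟨i, j, -, hij, rfl⟩ | ⟨i, j, k, -, -, -, -, rfl⟩)
  · rw [SetLike.mem_coe, TwoSidedIdeal.mem_ker]
    simp only [gen, map_mul, ExteriorAlgebra.map_apply_ι, sumPair_single, hC i j (Or.inr hij),
      ExteriorAlgebra.ι_sq_zero]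
  · rw [SetLike.mem_coe, TwoSidedIdeal.mem_ker]
    have hsub (r s : R) : (![1, r] - ![1, s] : Fin 2 → R) = (r - s) • ![0, 1] := by
      ext m
      fin_cases m <;> simp
    simp only [gen, map_add, map_sub, map_mul, ExteriorAlgebra.map_apply_ι, sumPair_single]
    rw [ExteriorAlgebra.ι_mul_sub_add, hsub, hsub, map_smul, map_smul, smul_mul_smul_comm,
      ExteriorAlgebra.ι_sq_zero, smul_zero]

/-- Lemma 3.3 of the paper. If `ξ = Σ aᵢeᵢ` has invertible coefficient
sum, `η = Σ cᵢeᵢ` has coefficient sum zero and `ξ ∧ η ∈ I_R(𝒜)`, then the sum of the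
coefficients of `η` over each parallel class vanishes (i.e. `η ∈ ker Δ_tot`). -/
theorem ker_total_degeneration
    {n : ℕ} (hn : 1 ≤ n) (L : Fin n → AffineSubspace ℂ (ℂ × ℂ))
    (hline : ∀ i, IsLine (L i)) (hdist : Function.Injective L)
    (R : Type*) [CommRing R] (a c : Fin n → R)
    (ha : IsUnit (∑ i, a i)) (hc : ∑ i, c i = 0)
    (hker : (∑ i, a i • gen R n i) * (∑ i, c i • gen R n i) ∈ osIdeal R L) :
    ∀ i : Fin n, ∑ j ∈ parClass L i, c j = 0 := by
  intro i
  have hC : ∀ j k, Par L j k → (j ∈ parClass L i ↔ k ∈ parClass L i) := by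
    intro j k hjk
    simp only [parClass, Finset.mem_filter, Finset.mem_univ, true_and,
      par_iff_direction_eq hline hdist] at hjk ⊢
    rw [hjk]
  have h := map_sumPair_eq_zero_of_mem_osIdeal hC hker
  rw [sum_smul_gen, sum_smul_gen, map_mul, ExteriorAlgebra.map_apply_ι,
    ExteriorAlgebra.map_apply_ι, sumPair_apply, sumPair_apply, hc] at h
  have hdet := ExteriorAlgebra.det_eq_zero_of_ι_mul_ι_eq_zero h
  simp only [Matrix.cons_val_zero, Matrix.cons_val_one, mul_zero, sub_zero] at hdet
  exact ha.mul_right_eq_zero.mp hdet
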